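/- arXiv:2510.21952 — 2 statements merged into one kernel-verified Lean document; each statement's English description precedes it below -/
import Mathlib

section
/- Let A ∈ ℝ^{d×d} be a symmetric positive semidefinite matrix with eigenvalues λ_1 ≥ … ≥ λ_d ≥ 0 and a corresponding orthonormal family of eigenvectors w_1, …, w_d (so A w_i = λ_i w_i), let k ≤ d, and let p ≥ 1 be an integer. If W ∈ ℝ^{d×k} is the matrix whose columns are w_1, …, w_k, then tr((I_d − W Wᵀ)^{2p} A) = Σ_{i=k+1}^{d} λ_i. Consequently, the infimum of the OMM-p objective L_p(V) := tr((I_d − V Vᵀ)^{2p} A) − tr(A) over all V ∈ ℝ^{d×k} equals −Σ_{i=1}^{k} λ_i and is attained at V = W. -/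
open Matrix

/-- A real matrix of the form `V Vᵀ` with `V` having `k` columns is orthogonally diagonalizable with
at most `k` nonzero eigenvalues. -/
lemma exists_orthogonal_diagonalization_mul_transpose {d k : ℕ} (V : Matrix (Fin d) (Fin k) ℝ) :
    ∃ (U : Matrix (Fin d) (Fin d) ℝ) (e : Fin d → ℝ), Uᵀ * U = 1 ∧
      V * Vᵀ = U * diagonal e * Uᵀ ∧ (Finset.univ.filter fun j => e j ≠ 0).card ≤ k := by
  have hV : (V * Vᵀ).IsHermitian := by
    simpa [conjTranspose_eq_transpose_of_trivial] using isHermitian_mul_conjTranspose_self V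
  refine ⟨hV.eigenvectorUnitary, hV.eigenvalues, ?_, ?_, ?_⟩
  · simpa [star_eq_conjTranspose, conjTranspose_eq_transpose_of_trivial] using
      Unitary.coe_star_mul_self hV.eigenvectorUnitary
  · have h := hV.spectral_theorem
    rw [Unitary.conjStarAlgAut_apply] at h
    simpa [star_eq_conjTranspose, conjTranspose_eq_transpose_of_trivial] using h
  · have h := hV.rank_eq_card_non_zero_eigs
    rw [Fintype.card_subtype] at h
    rw [← h]
    exact (rank_mul_le_left V Vᵀ).trans (by simpa using V.rank_le_width)

/-- Powers of `1 - U D Uᵀ` for orthogonal `U` and diagonal `D`. -/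
lemma one_sub_orthogonal_conj_diagonal_pow {n : Type*} [Fintype n] [DecidableEq n]
    {U : Matrix n n ℝ} (hU : Uᵀ * U = 1) (e : n → ℝ) (m : ℕ) :
    (1 - U * diagonal e * Uᵀ) ^ m = U * diagonal (fun j => (1 - e j) ^ m) * Uᵀ := by
  have hU' : U * Uᵀ = 1 := mul_eq_one_comm.mp hU
  induction m with
  | zero => simp [hU']
  | succ m ih =>
    have h1 : 1 - U * diagonal e * Uᵀ = U * diagonal (fun j => 1 - e j) * Uᵀ := by
      have : diagonal (fun j => 1 - e j) = 1 - diagonal e := by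
        rw [← diagonal_one, diagonal_sub]
      rw [this, mul_sub, sub_mul, mul_one, hU']
    rw [pow_succ, ih, h1]
    calc U * diagonal (fun j => (1 - e j) ^ m) * Uᵀ * (U * diagonal (fun j => 1 - e j) * Uᵀ)
        = U * diagonal (fun j => (1 - e j) ^ m) * (Uᵀ * U) * diagonal (fun j => 1 - e j) * Uᵀ := by
          simp only [Matrix.mul_assoc]
      _ = _ := by
          rw [hU, mul_one, Matrix.mul_assoc U, diagonal_mul_diagonal]
          simp only [pow_succ]

lemma trace_conj_diagonal_mul_conj_diagonal {n : Type*} [Fintype n] [DecidableEq n]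
    (U W : Matrix n n ℝ) (f μ : n → ℝ) :
    ((U * diagonal f * Uᵀ) * (W * diagonal μ * Wᵀ)).trace
      = ∑ i, μ i * ∑ j, f j * (Uᵀ * W) j i ^ 2 := by
  have h : ((U * diagonal f * Uᵀ) * (W * diagonal μ * Wᵀ)).trace
      = ((Uᵀ * W)ᵀ * (diagonal f * ((Uᵀ * W) * diagonal μ))).trace := by
    rw [← Matrix.mul_assoc, trace_mul_comm, transpose_mul, transpose_transpose]
    simp only [Matrix.mul_assoc]
  rw [h, trace]
  refine Finset.sum_congr rfl fun i _ => ?_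
  rw [diag_apply, mul_apply, Finset.mul_sum]
  refine Finset.sum_congr rfl fun j _ => ?_
  rw [diagonal_mul, mul_diagonal, transpose_apply]
  ring

/-- Among weights in `[0, 1]` of total mass at most `k`, the weighted sum of an antitone nonnegative
family is maximized by putting full weight on the first `k` entries. -/
lemma sum_mul_le_sum_filter_val_lt_of_antitone {d k : ℕ} (hk : k ≤ d) {μ : Fin d → ℝ}
    (hμ : Antitone μ) (hμ0 : ∀ i, 0 ≤ μ i) {q : Fin d → ℝ} (hq0 : ∀ i, 0 ≤ q i)
    (hq1 : ∀ i, q i ≤ 1) (hq : ∑ i, q i ≤ k) :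
    ∑ i, μ i * q i ≤ ∑ i ∈ Finset.univ.filter (fun i : Fin d => (i : ℕ) < k), μ i := by
  obtain ⟨c, hc0, hlt, hge⟩ : ∃ c : ℝ, 0 ≤ c ∧ (∀ i : Fin d, (i : ℕ) < k → c ≤ μ i) ∧
      ∀ i : Fin d, k ≤ (i : ℕ) → μ i ≤ c := by
    rcases hk.lt_or_eq with h | h
    · exact ⟨μ ⟨k, h⟩, hμ0 _, fun i hi => hμ (Fin.le_def.mpr hi.le),
        fun i hi => hμ (Fin.le_def.mpr hi)⟩
    · exact ⟨0, le_rfl, fun i _ => hμ0 i, fun i hi => absurd i.isLt (by omega)⟩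
  have hcard : ∑ i : Fin d, (if (i : ℕ) < k then (1 : ℝ) else 0) = k := by
    rw [Finset.sum_boole, Fin.card_filter_val_lt, min_eq_right hk]
  have hpt : ∀ i : Fin d, c * ((if (i : ℕ) < k then (1 : ℝ) else 0) - q i)
      ≤ (if (i : ℕ) < k then μ i else 0) - μ i * q i := by
    intro i
    split_ifs with h
    · nlinarith [hlt i h, hq1 i]
    · nlinarith [hge i (not_lt.mp h), hq0 i]
  have hsum := Finset.sum_le_sum fun i (_ : i ∈ Finset.univ) => hpt i
  rw [← Finset.mul_sum, Finset.sum_sub_distrib, Finset.sum_sub_distrib, hcard] at hsum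
  rw [Finset.sum_filter]
  nlinarith [mul_nonneg hc0 (sub_nonneg.mpr hq)]

lemma sum_sq_apply_col_of_transpose_mul_self {n : Type*} [Fintype n] [DecidableEq n]
    {P : Matrix n n ℝ} (hP : Pᵀ * P = 1) (i : n) : ∑ j, P j i ^ 2 = 1 := by
  have h := congrFun (congrFun hP i) i
  rw [mul_apply, one_apply_eq] at h
  simpa [sq] using h

/-- Lower bound for the OMM objective in the orthogonal diagonalization of `A`. -/
lemma sum_sub_sum_filter_le_trace_one_sub_mul_transpose_pow {d k : ℕ} (hk : k ≤ d) (p : ℕ)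
    {μ : Fin d → ℝ} (hμ : Antitone μ) (hμ0 : ∀ i, 0 ≤ μ i)
    {W : Matrix (Fin d) (Fin d) ℝ} (hW : Wᵀ * W = 1) (V : Matrix (Fin d) (Fin k) ℝ) :
    ∑ i, μ i - ∑ i ∈ Finset.univ.filter (fun i : Fin d => (i : ℕ) < k), μ i
      ≤ (((1 - V * Vᵀ) ^ (2 * p)) * (W * diagonal μ * Wᵀ)).trace := by
  obtain ⟨U, e, hU, hVU, hcard⟩ := exists_orthogonal_diagonalization_mul_transpose V
  rw [hVU, one_sub_orthogonal_conj_diagonal_pow hU, trace_conj_diagonal_mul_conj_diagonal]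
  have hU' : U * Uᵀ = 1 := mul_eq_one_comm.mp hU
  set P := Uᵀ * W with hPdef
  have hP : Pᵀ * P = 1 := by
    rw [hPdef, transpose_mul, transpose_transpose, Matrix.mul_assoc, ← Matrix.mul_assoc U, hU',
      Matrix.one_mul, hW]
  have hP' : Pᵀᵀ * Pᵀ = 1 := by
    rw [transpose_transpose]
    exact mul_eq_one_comm.mp hP
  have hcol := sum_sq_apply_col_of_transpose_mul_self hP
  have hrow := sum_sq_apply_col_of_transpose_mul_self hP'
  simp only [transpose_apply] at hrow
  set q : Fin d → ℝ := fun i => ∑ j, (if e j ≠ 0 then (1 : ℝ) else 0) * P j i ^ 2 with hqdef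
  have hq0 : ∀ i, 0 ≤ q i := fun i => Finset.sum_nonneg fun j _ =>
    mul_nonneg (by split_ifs <;> norm_num) (sq_nonneg _)
  have hq1 : ∀ i, q i ≤ 1 := fun i => by
    rw [← hcol i]
    exact Finset.sum_le_sum fun j _ =>
      mul_le_of_le_one_left (sq_nonneg _) (by split_ifs <;> norm_num)
  have hq : ∑ i, q i ≤ k := by
    rw [hqdef, Finset.sum_comm]
    simp_rw [← Finset.mul_sum, hrow, mul_one]
    rw [Finset.sum_boole]
    exact_mod_cast hcard
  have hle : ∀ i, 1 - q i ≤ ∑ j, (1 - e j) ^ (2 * p) * P j i ^ 2 := fun i => by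
    have hsub : 1 - q i = ∑ j, (P j i ^ 2 - (if e j ≠ 0 then (1 : ℝ) else 0) * P j i ^ 2) := by
      rw [Finset.sum_sub_distrib, hcol i]
    rw [hsub]
    refine Finset.sum_le_sum fun j _ => ?_
    by_cases h : e j = 0
    · simp [h]
    · simpa [h] using mul_nonneg ((even_two_mul p).pow_nonneg (1 - e j)) (sq_nonneg (P j i))
  have hmain := sum_mul_le_sum_filter_val_lt_of_antitone hk hμ hμ0 hq0 hq1 hq
  have hsum := Finset.sum_le_sum fun i (_ : i ∈ Finset.univ) =>
    mul_le_mul_of_nonneg_left (hle i) (hμ0 i)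
  simp only [mul_sub, mul_one, Finset.sum_sub_distrib] at hsum
  linarith

lemma submatrix_castLE_mul_transpose {d k : ℕ} (hk : k ≤ d) (W : Matrix (Fin d) (Fin d) ℝ) :
    W.submatrix id (Fin.castLE hk) * (W.submatrix id (Fin.castLE hk))ᵀ
      = W * diagonal (fun i : Fin d => if (i : ℕ) < k then (1 : ℝ) else 0) * Wᵀ := by
  ext a b
  rw [mul_apply, mul_apply]
  simp only [mul_diagonal, submatrix_apply, transpose_apply, id_eq, mul_ite, mul_one, mul_zero,
    ite_mul, zero_mul]
  rw [← Finset.sum_filter]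
  refine Finset.sum_bij (fun i _ => Fin.castLE hk i) ?_ ?_ ?_ ?_
  · simp
  · intro i _ j _ h
    exact Fin.castLE_injective hk h
  · intro i hi
    exact ⟨⟨i, (Finset.mem_filter.mp hi).2⟩, Finset.mem_univ _, rfl⟩
  · simp

/-- Consistency of the OMM-p objective (value at the top-k eigenbasis): if `A` is
symmetric PSD with eigenvalues `μ 0 ≥ … ≥ μ (d−1) ≥ 0` and orthonormal eigenvectors
given by the columns of `W` (`Wᵀ W = I`, `A W = W diag(μ)`), `k ≤ d`, `p ≥ 1`, and
`Wk` consists of the first `k` columns of `W`, then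
`tr((I_d − Wk Wkᵀ)^{2p} A) = Σ_{i ≥ k} μ i`; consequently the OMM-p objective
`L_p(V) = tr((I_d − V Vᵀ)^{2p} A) − tr(A)` has infimum `−Σ_{i < k} μ i` over
`V ∈ ℝ^{d×k}`, attained at `V = Wk`. -/
theorem ommp_consistency_value (d k p : ℕ) (hk : k ≤ d) (hp : 1 ≤ p)
    (A : Matrix (Fin d) (Fin d) ℝ) (hA : A.PosSemidef)
    (μ : Fin d → ℝ) (hμ : Antitone μ) (hμ0 : ∀ i, 0 ≤ μ i)
    (W : Matrix (Fin d) (Fin d) ℝ) (hW : Wᵀ * W = 1)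
    (hAW : A * W = W * Matrix.diagonal μ)
    (Wk : Matrix (Fin d) (Fin k) ℝ) (hWk : Wk = W.submatrix id (Fin.castLE hk)) :
    (((1 - Wk * Wkᵀ) ^ (2 * p)) * A).trace
        = ∑ i ∈ Finset.univ.filter (fun i : Fin d => k ≤ (i : ℕ)), μ i
      ∧ (((1 - Wk * Wkᵀ) ^ (2 * p)) * A).trace - A.trace
        = -∑ i ∈ Finset.univ.filter (fun i : Fin d => (i : ℕ) < k), μ i
      ∧ IsLeast
          (Set.range fun V : Matrix (Fin d) (Fin k) ℝ =>
            (((1 - V * Vᵀ) ^ (2 * p)) * A).trace - A.trace)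
          (-∑ i ∈ Finset.univ.filter (fun i : Fin d => (i : ℕ) < k), μ i) := by
  have hW' : W * Wᵀ = 1 := mul_eq_one_comm.mp hW
  have hAeq : A = W * diagonal μ * Wᵀ := by
    rw [← hAW, Matrix.mul_assoc, hW', Matrix.mul_one]
  have htr : A.trace = ∑ i, μ i := by
    rw [hAeq, trace_mul_comm, ← Matrix.mul_assoc, hW, Matrix.one_mul, trace_diagonal]
  have hsplit : ∑ i ∈ Finset.univ.filter (fun i : Fin d => (i : ℕ) < k), μ i
      + ∑ i ∈ Finset.univ.filter (fun i : Fin d => k ≤ (i : ℕ)), μ i = ∑ i, μ i := by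
    simpa only [not_lt] using
      Finset.sum_filter_add_sum_filter_not Finset.univ (fun i : Fin d => (i : ℕ) < k) μ
  have hval : (((1 - Wk * Wkᵀ) ^ (2 * p)) * A).trace
      = ∑ i ∈ Finset.univ.filter (fun i : Fin d => k ≤ (i : ℕ)), μ i := by
    rw [hWk, submatrix_castLE_mul_transpose, one_sub_orthogonal_conj_diagonal_pow hW, hAeq,
      trace_conj_diagonal_mul_conj_diagonal, hW, Finset.sum_filter]
    refine Finset.sum_congr rfl fun i _ => ?_
    rw [Finset.sum_eq_single i (fun j _ hj => by simp [one_apply_ne hj]) (by simp)]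
    by_cases h : (i : ℕ) < k
    · simp [h, Nat.one_le_iff_ne_zero.mp hp]
    · simp [h, not_lt.mp h]
  refine ⟨hval, by linarith, ⟨Wk, ?_⟩, ?_⟩
  · change (((1 - Wk * Wkᵀ) ^ (2 * p)) * A).trace - A.trace = _
    linarith
  · rintro _ ⟨V, rfl⟩
    have h := sum_sub_sum_filter_le_trace_one_sub_mul_transpose_pow hk p hμ hμ0 hW V
    rw [← hAeq] at h
    change _ ≤ (((1 - V * Vᵀ) ^ (2 * p)) * A).trace - A.trace
    linarith
end

section
/- Let A ∈ ℝ^{d×d} be a symmetric positive semidefinite matrix with eigenvalues λ_1 ≥ … ≥ λ_d ≥ 0 and a corresponding orthonormal family of eigenvectors w_1, …, w_d, let 1 ≤ k < d, and assume the spectral gap λ_k > λ_{k+1}. Let p ≥ 1 be an integer. If V ∈ ℝ^{d×k} satisfies tr((I_d − V Vᵀ)^{2p} A) = Σ_{i=k+1}^{d} λ_i (i.e., V is a global minimizer of the OMM-p objective), then V Vᵀ = Σ_{i=1}^{k} w_i w_iᵀ, the orthogonal projection onto the top-k eigensubspace of A. -/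
open Matrix

/-- A weighted rearrangement bound with its equality case: weights `q ≤ min c 1` of total mass at
least `d - k` cannot pair with `μ` to less than the tail sum of `μ`, and in case of
equality `c` vanishes on the first `k` indices while `q` equals one on the others. -/
theorem weights_eq_of_sum_mul_eq_tail {d k : ℕ} (hk1 : 1 ≤ k) (hk : k < d)
    {μ : Fin d → ℝ} (hμ : Antitone μ) (hμ0 : ∀ i, 0 ≤ μ i)
    (hgap : μ ⟨k, hk⟩ < μ ⟨k - 1, by omega⟩) {c q : Fin d → ℝ}
    (hq0 : ∀ i, 0 ≤ q i) (hq1 : ∀ i, q i ≤ 1) (hqc : ∀ i, q i ≤ c i)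
    (hq : (d : ℝ) - k ≤ ∑ i, q i)
    (hc : ∑ i, c i * μ i = ∑ i ∈ Finset.univ.filter (fun i : Fin d => k ≤ (i : ℕ)), μ i) :
    (∀ i : Fin d, (i : ℕ) < k → c i = 0) ∧ ∀ i : Fin d, k ≤ (i : ℕ) → q i = 1 := by
  set a := μ ⟨k - 1, by omega⟩
  set b := μ ⟨k, hk⟩
  have hb0 : 0 ≤ b := hμ0 _
  have hlow : ∀ i : Fin d, (i : ℕ) < k → a ≤ μ i := fun i hi =>
    hμ (Fin.le_def.2 (Nat.le_sub_one_of_lt hi))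
  have hhigh : ∀ i : Fin d, k ≤ (i : ℕ) → μ i ≤ b := fun i hi => hμ (Fin.le_def.2 hi)
  let t : Fin d → ℝ := fun i => if k ≤ (i : ℕ) then 1 else 0
  have ht : ∑ i, t i = d - k := by
    have hcard : (Finset.univ.filter (fun i : Fin d => k ≤ (i : ℕ))).card = d - k := by
      have : Finset.univ.filter (fun i : Fin d => k ≤ (i : ℕ)) = Finset.Ici ⟨k, hk⟩ := by
        ext i; simp [Fin.le_def]
      rw [this, Fin.card_Ici]
    simp only [t, Finset.sum_boole, hcard]
    exact Nat.cast_sub hk.le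
  -- nonnegative slack at each index
  let e : Fin d → ℝ := fun i =>
    (c i - q i) * μ i + (q i - t i) * (μ i - b)
  have he0 : ∀ i, 0 ≤ e i := by
    intro i
    have h1 : 0 ≤ (c i - q i) * μ i := mul_nonneg (sub_nonneg.2 (hqc i)) (hμ0 i)
    have h2 : 0 ≤ (q i - t i) * (μ i - b) := by
      by_cases hi : k ≤ (i : ℕ)
      · simp only [t, if_pos hi]
        exact mul_nonneg_of_nonpos_of_nonpos (by linarith [hq1 i]) (by linarith [hhigh i hi])
      · simp only [t, if_neg hi]
        exact mul_nonneg (by linarith [hq0 i]) (by linarith [hlow i (not_le.1 hi)])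
    exact add_nonneg h1 h2
  have htail : ∑ i, t i * μ i =
      ∑ i ∈ Finset.univ.filter (fun i : Fin d => k ≤ (i : ℕ)), μ i := by
    simp [t, Finset.sum_filter]
  have hsum : ∑ i, e i = - (b * (∑ i, q i - ∑ i, t i)) := by
    have : ∑ i, e i = ∑ i, c i * μ i - ∑ i, t i * μ i - b * (∑ i, q i - ∑ i, t i) := by
      simp only [← Finset.sum_sub_distrib, Finset.mul_sum]
      exact Finset.sum_congr rfl fun i _ => by simp only [e]; ring
    rw [this, hc, htail]; ring
  have hmass : 0 ≤ ∑ i, q i - ∑ i, t i := by linarith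
  have hez : ∀ i, e i = 0 := by
    have h0 : ∑ i, e i = 0 := le_antisymm
      (by rw [hsum]; exact neg_nonpos.2 (mul_nonneg hb0 hmass))
      (Finset.sum_nonneg fun i _ => he0 i)
    exact fun i => (Finset.sum_eq_zero_iff_of_nonneg fun i _ => he0 i).1 h0 i (Finset.mem_univ i)
  have hcq : ∀ i : Fin d, (i : ℕ) < k → c i = 0 ∧ q i = 0 := by
    intro i hi
    have h := hez i
    have hai := hlow i hi
    simp only [e, t, if_neg (not_le.2 hi), sub_zero] at h
    have h1 : 0 ≤ (c i - q i) * μ i := mul_nonneg (sub_nonneg.2 (hqc i)) (hμ0 i)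
    have h2 : 0 ≤ q i * (μ i - b) := mul_nonneg (hq0 i) (by linarith)
    have hqi : q i = 0 :=
      (mul_eq_zero.1 (show q i * (μ i - b) = 0 by linarith)).resolve_right (by linarith)
    have hci : c i - q i = 0 :=
      (mul_eq_zero.1 (show (c i - q i) * μ i = 0 by linarith)).resolve_right (by linarith)
    exact ⟨by linarith, hqi⟩
  refine ⟨fun i hi => (hcq i hi).1, fun i hi => ?_⟩
  have hnn : ∀ i ∈ Finset.univ, 0 ≤ t i - q i := by
    intro i _
    by_cases hi : k ≤ (i : ℕ)
    · simp only [t, if_pos hi]; linarith [hq1 i]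
    · simp only [t, if_neg hi]; linarith [(hcq i (not_le.1 hi)).2]
  have h0 : ∑ i, (t i - q i) = 0 := le_antisymm
    (by rw [Finset.sum_sub_distrib]; linarith) (Finset.sum_nonneg hnn)
  have := (Finset.sum_eq_zero_iff_of_nonneg hnn).1 h0 i (Finset.mem_univ i)
  simp only [t, if_pos hi] at this
  linarith

/-- A real symmetric matrix is orthogonally diagonalized, with as many nonzero diagonal entries
as its rank. -/
theorem exists_orthogonal_diagonalization {n : Type*} [Fintype n] [DecidableEq n]
    {B : Matrix n n ℝ} (hB : B.IsHermitian) :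
    ∃ (U : Matrix n n ℝ) (β : n → ℝ), Uᵀ * U = 1 ∧ U * Uᵀ = 1 ∧ B = U * diagonal β * Uᵀ ∧
      (Finset.univ.filter fun j => β j ≠ 0).card = B.rank := by
  refine ⟨hB.eigenvectorUnitary, hB.eigenvalues, ?_, ?_, ?_, ?_⟩
  · simpa [star_eq_conjTranspose] using Unitary.coe_star_mul_self hB.eigenvectorUnitary
  · simpa [star_eq_conjTranspose] using Unitary.coe_mul_star_self hB.eigenvectorUnitary
  · have := hB.spectral_theorem
    simpa [Unitary.conjStarAlgAut_apply, star_eq_conjTranspose, Function.comp_def] using this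
  · rw [hB.rank_eq_card_non_zero_eigs, Fintype.card_subtype]

theorem trace_mul_of_diagonalizations {n : Type*} [Fintype n] [DecidableEq n]
    (U W : Matrix n n ℝ) (m μ : n → ℝ) :
    ((U * diagonal m * Uᵀ) * (W * diagonal μ * Wᵀ)).trace
      = ∑ i, (∑ j, m j * (Uᵀ * W) j i ^ 2) * μ i := by
  have : ((U * diagonal m * Uᵀ) * (W * diagonal μ * Wᵀ)).trace
      = ((diagonal m * (Uᵀ * W)) * (diagonal μ * (Uᵀ * W)ᵀ)).trace := by
    rw [transpose_mul, transpose_transpose, Matrix.mul_assoc, Matrix.mul_assoc,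
      trace_mul_comm]
    simp only [Matrix.mul_assoc]
  rw [this, trace, Finset.sum_congr rfl fun j _ => by rw [diag_apply, mul_apply],
    Finset.sum_comm]
  refine Finset.sum_congr rfl fun i _ => ?_
  rw [Finset.sum_mul]
  refine Finset.sum_congr rfl fun j _ => ?_
  rw [diagonal_mul, diagonal_mul, transpose_apply]
  ring

theorem sum_sq_col_of_orthogonal {n : Type*} [Fintype n] [DecidableEq n] {R : Matrix n n ℝ}
    (hR : Rᵀ * R = 1) (i : n) : ∑ j, R j i ^ 2 = 1 := by
  have := congrFun (congrFun hR i) i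
  simpa [mul_apply, sq] using this

theorem one_sub_conj_diagonal_pow {n : Type*} [Fintype n] [DecidableEq n] {U : Matrix n n ℝ}
    (hU : Uᵀ * U = 1) (hU' : U * Uᵀ = 1) (β : n → ℝ) (r : ℕ) :
    (1 - U * diagonal β * Uᵀ) ^ r = U * diagonal (fun j => (1 - β j) ^ r) * Uᵀ := by
  have h1 : 1 - U * diagonal β * Uᵀ = U * diagonal (fun j => 1 - β j) * Uᵀ := by
    rw [← diagonal_sub, diagonal_one, Matrix.mul_sub, Matrix.sub_mul, Matrix.mul_one, hU']
  induction r with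
  | zero => simp [hU']
  | succ r ih =>
    rw [pow_succ, ih, h1]
    calc _ = U * diagonal (fun j => (1 - β j) ^ r) * (Uᵀ * U) *
          diagonal (fun j => 1 - β j) * Uᵀ := by simp only [Matrix.mul_assoc]
      _ = _ := by
        rw [hU, Matrix.mul_one, Matrix.mul_assoc U, diagonal_mul_diagonal]
        simp only [pow_succ]

/-- Uniqueness part of the consistency of the OMM-p objective: if `A` is symmetric
PSD with eigenvalues `μ 0 ≥ … ≥ μ (d−1) ≥ 0` and orthonormal eigenvectors given by
the columns of `W`, `1 ≤ k < d`, with spectral gap `μ (k−1) > μ k` (1-indexed: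
`λ_k > λ_{k+1}`), `p ≥ 1`, and `V ∈ ℝ^{d×k}` attains the global minimum of the
OMM-p objective, i.e. `tr((I_d − V Vᵀ)^{2p} A) = Σ_{i ≥ k} μ i`, then
`V Vᵀ = Σ_{i < k} w_i w_iᵀ`, the orthogonal projection onto the top-k
eigensubspace of `A`. -/
theorem ommp_minimizer_is_projection (d k p : ℕ) (hk1 : 1 ≤ k) (hk : k < d) (hp : 1 ≤ p)
    (A : Matrix (Fin d) (Fin d) ℝ) (hA : A.PosSemidef)
    (μ : Fin d → ℝ) (hμ : Antitone μ) (hμ0 : ∀ i, 0 ≤ μ i)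
    (hgap : μ ⟨k, hk⟩ < μ ⟨k - 1, by omega⟩)
    (W : Matrix (Fin d) (Fin d) ℝ) (hW : Wᵀ * W = 1)
    (hAW : A * W = W * Matrix.diagonal μ)
    (V : Matrix (Fin d) (Fin k) ℝ)
    (hmin : (((1 - V * Vᵀ) ^ (2 * p)) * A).trace
      = ∑ i ∈ Finset.univ.filter (fun i : Fin d => k ≤ (i : ℕ)), μ i) :
    V * Vᵀ = ∑ i ∈ Finset.univ.filter (fun i : Fin d => (i : ℕ) < k),
      vecMulVec (fun a => W a i) (fun a => W a i) := by
  have hW' : W * Wᵀ = 1 := mul_eq_one_comm.1 hW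
  have hA' : A = W * diagonal μ * Wᵀ := by
    rw [← hAW, Matrix.mul_assoc, hW', Matrix.mul_one]
  have hB : (V * Vᵀ).IsHermitian := by
    simpa using isHermitian_mul_conjTranspose_self V
  obtain ⟨U, β, hU, hU', hUB, hrank⟩ := exists_orthogonal_diagonalization hB
  have hcard : (Finset.univ.filter fun j => β j ≠ 0).card ≤ k := by
    rw [hrank]
    refine (rank_mul_le_left V Vᵀ).trans ?_
    simpa using V.rank_le_card_width
  set R := Uᵀ * W with hR
  have hRR : Rᵀ * R = 1 := by
    rw [hR, transpose_mul, transpose_transpose, Matrix.mul_assoc, ← Matrix.mul_assoc U, hU',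
      Matrix.one_mul, hW]
  have hRR' : R * Rᵀ = 1 := mul_eq_one_comm.1 hRR
  have hcol : ∀ i, ∑ j, R j i ^ 2 = 1 := sum_sq_col_of_orthogonal hRR
  have hrow : ∀ j, ∑ i, R j i ^ 2 = 1 := fun j =>
    sum_sq_col_of_orthogonal (R := Rᵀ) (by rwa [transpose_transpose]) j
  rw [hUB, one_sub_conj_diagonal_pow hU hU', hA', trace_mul_of_diagonalizations] at hmin
  let z : Fin d → ℝ := fun j => if β j = 0 then 1 else 0
  have hz0 : ∀ j, 0 ≤ z j := fun j => by simp only [z]; split_ifs <;> norm_num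
  have hz1 : ∀ j, z j ≤ 1 := fun j => by simp only [z]; split_ifs <;> norm_num
  have hm0 : ∀ j, 0 ≤ (1 - β j) ^ (2 * p) := fun j => (even_two_mul p).pow_nonneg _
  have hzm : ∀ j, z j ≤ (1 - β j) ^ (2 * p) := fun j => by
    by_cases h : β j = 0
    · simp [z, h]
    · simpa [z, h] using hm0 j
  have hzsum : (d : ℝ) - k ≤ ∑ j, z j := by
    have h1 := Finset.card_filter_add_card_filter_not (s := (Finset.univ : Finset (Fin d)))
      (fun j => β j = 0)
    rw [Finset.card_univ, Fintype.card_fin] at h1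
    have h2 : d ≤ (Finset.univ.filter fun j => β j = 0).card + k := by
      have := hcard
      simp only [ne_eq] at this
      omega
    have h3 : (d : ℝ) ≤ (Finset.univ.filter fun j => β j = 0).card + k := by exact_mod_cast h2
    simp only [z, Finset.sum_boole]
    linarith
  obtain ⟨hlow, hhigh⟩ := weights_eq_of_sum_mul_eq_tail hk1 hk hμ hμ0 hgap
    (c := fun i => ∑ j, (1 - β j) ^ (2 * p) * R j i ^ 2) (q := fun i => ∑ j, z j * R j i ^ 2)
    (fun i => Finset.sum_nonneg fun j _ => mul_nonneg (hz0 j) (sq_nonneg _))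
    (fun i => (Finset.sum_le_sum fun j _ =>
      mul_le_of_le_one_left (sq_nonneg (R j i)) (hz1 j)).trans_eq (hcol i))
    (fun i => Finset.sum_le_sum fun j _ => mul_le_mul_of_nonneg_right (hzm j) (sq_nonneg _))
    (by
      rw [Finset.sum_comm]
      simpa only [← Finset.mul_sum, hrow, mul_one] using hzsum)
    hmin
  have hkey : diagonal β * R = R * diagonal (fun i : Fin d => if (i : ℕ) < k then 1 else 0) := by
    ext j i
    rw [diagonal_mul, mul_diagonal]
    by_cases hi : (i : ℕ) < k
    · have h := (Finset.sum_eq_zero_iff_of_nonneg fun j _ =>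
        mul_nonneg (hm0 j) (sq_nonneg (R j i))).1 (hlow i hi) j (Finset.mem_univ j)
      rw [if_pos hi, mul_one]
      rcases mul_eq_zero.1 h with h | h
      · rw [show β j = 1 by linarith [pow_eq_zero_iff (by omega) |>.1 h], one_mul]
      · rw [pow_eq_zero_iff two_ne_zero |>.1 h, mul_zero]
    · have h0 : ∑ j, (1 - z j) * R j i ^ 2 = 0 := by
        simp only [sub_mul, one_mul, Finset.sum_sub_distrib, hcol]
        linarith [hhigh i (not_lt.1 hi)]
      have h := (Finset.sum_eq_zero_iff_of_nonneg fun j _ =>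
        mul_nonneg (sub_nonneg.2 (hz1 j)) (sq_nonneg (R j i))).1 h0 j (Finset.mem_univ j)
      rw [if_neg hi, mul_zero]
      by_cases hβ : β j = 0
      · rw [hβ, zero_mul]
      · have : R j i = 0 := by simpa [z, hβ] using h
        rw [this, mul_zero]
  have hUW : Uᵀ = R * Wᵀ := by rw [hR, Matrix.mul_assoc, hW', Matrix.mul_one]
  have hUR : U * R = W := by rw [hR, ← Matrix.mul_assoc, hU', Matrix.one_mul]
  have hproj : V * Vᵀ = W * diagonal (fun i : Fin d => if (i : ℕ) < k then 1 else 0) * Wᵀ := by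
    calc V * Vᵀ = U * (diagonal β * R) * Wᵀ := by
          rw [hUB, hUW]; simp only [Matrix.mul_assoc]
      _ = _ := by rw [hkey, ← Matrix.mul_assoc, hUR]
  rw [hproj]
  ext a b
  rw [mul_apply, Matrix.sum_apply, Finset.sum_filter]
  refine Finset.sum_congr rfl fun i _ => ?_
  rw [mul_diagonal, transpose_apply, vecMulVec_apply]
  split_ifs <;> simp
end
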